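/- Consider a finite Markov decision process: finite nonempty state set S and action set A, transition probabilities P : S × A × S → ℝ with P(s'|s,a) ≥ 0 and Σ_{s'} P(s'|s,a) = 1, an initial state distribution μ₀ on S, and a discount factor γ ∈ [0,1). Let π_φ : S × A → ℝ be a policy (π_φ(a|s) ≥ 0, Σ_a π_φ(a|s) = 1) with discounted visitation frequency d_φ(s,a) = (1−γ) Σ_{t=0}^∞ γ^t ρ_t(s,a), where ρ_0(s,a) = μ₀(s)π_φ(a|s) and ρ_{t+1}(s',a') = Σ_{s,a} ρ_t(s,a) P(s'|s,a) π_φ(a'|s'). Let d_b be a probability distribution on S × A whose state marginal ν(s) = Σ_a d_b(s,a) satisfies the discounted flow equation γ Σ_{s,a} d_b(s,a) P(s'|s,a) − ν(s') + (1−γ) μ₀(s') = 0 for all s'. Let g : S × A → ℝ and let f be the (unique) solution of f(s,a) = g(s,a) + γ Σ_{s'} P(s'|s,a) Σ_{a'} π_φ(a'|s') f(s',a'). Then Σ_{s,a} d_φ(s,a) g(s,a) − Σ_{s,a} d_b(s,a) g(s,a) = Σ_s ν(s) Σ_a π_φ(a|s) f(s,a) − Σ_{s,a} d_b(s,a) f(s,a).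 Consequently, for any class 𝒢 of reward functions, sup_{g∈𝒢} |E_{d_φ}[g] − E_{d_b}[g]| = sup_{f∈ℱ} |E_{(s,a)∼d_b}[f(s,a)] − E_{s∼ν, a∼π_φ(·|s)}[f(s,a)]| where ℱ is the set of solutions f corresponding to g ∈ 𝒢. -/

import Mathlib

open BigOperators

section BellmanHelpers

variable {S A : Type*} [Fintype S] [Fintype A]

/-- Pairing the Bellman equation with a weight `d` moves the transition operator onto `d`. -/
lemma sum_mul_bellman_eq {P : S → A → S → ℝ} {π : S → A → ℝ} {γ : ℝ} {g f : S → A → ℝ}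
    (hf : ∀ s a, f s a = g s a + γ * ∑ s', P s a s' * ∑ a', π s' a' * f s' a')
    (d : S → A → ℝ) :
    ∑ s, ∑ a, d s a * g s a = (∑ s, ∑ a, d s a * f s a)
      - ∑ s', γ * (∑ s, ∑ a, d s a * P s a s') * ∑ a', π s' a' * f s' a' := by
  generalize hV : (fun s' => ∑ a', π s' a' * f s' a') = V
  have hV' : ∀ s', ∑ a', π s' a' * f s' a' = V s' := fun s' => congrFun hV s'
  simp only [hV'] at hf ⊢
  have hswap : ∑ s', γ * (∑ s, ∑ a, d s a * P s a s') * V s'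
      = ∑ s, ∑ a, d s a * (γ * ∑ s', P s a s' * V s') := by
    simp only [Finset.mul_sum, Finset.sum_mul]
    rw [Finset.sum_comm]
    refine Finset.sum_congr rfl fun s _ => ?_
    rw [Finset.sum_comm]
    exact Finset.sum_congr rfl fun a _ => Finset.sum_congr rfl fun s' _ => by ring
  rw [hswap, ← Finset.sum_sub_distrib]
  refine Finset.sum_congr rfl fun s _ => ?_
  rw [← Finset.sum_sub_distrib]
  refine Finset.sum_congr rfl fun a _ => ?_
  rw [hf s a]
  ring

/-- State-action marginals of a Markov decision process are probability distributions. -/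
lemma stateAction_marginal_nonneg_sum_eq_one {P : S → A → S → ℝ}
    (hP_nonneg : ∀ s a s', 0 ≤ P s a s') (hP_sum : ∀ s a, ∑ s', P s a s' = 1)
    {π : S → A → ℝ} (hπ_nonneg : ∀ s a, 0 ≤ π s a) (hπ_sum : ∀ s, ∑ a, π s a = 1)
    {μ0 : S → ℝ} (hμ0_nonneg : ∀ s, 0 ≤ μ0 s) (hμ0_sum : ∑ s, μ0 s = 1)
    {ρ : ℕ → S → A → ℝ} (hρ0 : ∀ s a, ρ 0 s a = μ0 s * π s a)
    (hρsucc : ∀ t s' a', ρ (t + 1) s' a' = (∑ s, ∑ a, ρ t s a * P s a s') * π s' a') (t : ℕ) :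
    (∀ s a, 0 ≤ ρ t s a) ∧ ∑ s, ∑ a, ρ t s a = 1 := by
  induction t with
  | zero =>
    refine ⟨fun s a => hρ0 s a ▸ mul_nonneg (hμ0_nonneg s) (hπ_nonneg s a), ?_⟩
    simp only [hρ0, ← Finset.mul_sum, hπ_sum, mul_one, hμ0_sum]
  | succ t ih =>
    refine ⟨fun s' a' => hρsucc t s' a' ▸ mul_nonneg (Finset.sum_nonneg fun s _ =>
      Finset.sum_nonneg fun a _ => mul_nonneg (ih.1 s a) (hP_nonneg s a s')) (hπ_nonneg s' a'), ?_⟩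
    simp only [hρsucc, ← Finset.mul_sum, hπ_sum, mul_one]
    rw [Finset.sum_comm, ← ih.2]
    refine Finset.sum_congr rfl fun s _ => ?_
    rw [Finset.sum_comm]
    simp only [← Finset.mul_sum, hP_sum, mul_one]

/-- The discounted visitation frequency satisfies its own flow equation. -/
lemma discounted_visitation_flow {P : S → A → S → ℝ} {π : S → A → ℝ} {μ0 : S → ℝ} {γ : ℝ}
    {ρ : ℕ → S → A → ℝ} (hρ0 : ∀ s a, ρ 0 s a = μ0 s * π s a)
    (hρsucc : ∀ t s' a', ρ (t + 1) s' a' = (∑ s, ∑ a, ρ t s a * P s a s') * π s' a')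
    (hsum : ∀ s a, Summable fun t : ℕ => γ ^ t * ρ t s a)
    {d : S → A → ℝ} (hd : ∀ s a, d s a = (1 - γ) * ∑' t : ℕ, γ ^ t * ρ t s a) (s' : S) (a' : A) :
    d s' a' = ((1 - γ) * μ0 s' + γ * ∑ s, ∑ a, d s a * P s a s') * π s' a' := by
  have hshift : HasSum (fun t : ℕ => γ ^ (t + 1) * ρ (t + 1) s' a')
      (γ * (∑ s, ∑ a, (∑' t : ℕ, γ ^ t * ρ t s a) * P s a s') * π s' a') := by
    have h : HasSum (fun t : ℕ => γ * (∑ s, ∑ a, γ ^ t * ρ t s a * P s a s') * π s' a')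
        (γ * (∑ s, ∑ a, (∑' t : ℕ, γ ^ t * ρ t s a) * P s a s') * π s' a') :=
      ((hasSum_sum fun s _ => hasSum_sum fun a _ =>
        (hsum s a).hasSum.mul_right (P s a s')).mul_left γ).mul_right (π s' a')
    refine h.congr_fun fun t => ?_
    simp only [hρsucc, pow_succ, mul_assoc, ← Finset.mul_sum]
    ring
  rw [hd s' a', (hsum s' a').tsum_eq_zero_add, hshift.tsum_eq, hρ0]
  simp only [hd, mul_assoc, ← Finset.mul_sum]
  ring

/-- The Bellman equation of a policy is solvable for every reward function. -/
lemma exists_bellman_solution [Nonempty S] [Nonempty A] {P : S → A → S → ℝ}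
    (hP_nonneg : ∀ s a s', 0 ≤ P s a s') (hP_sum : ∀ s a, ∑ s', P s a s' = 1)
    {π : S → A → ℝ} (hπ_nonneg : ∀ s a, 0 ≤ π s a) (hπ_sum : ∀ s, ∑ a, π s a = 1)
    {γ : ℝ} (hγ0 : 0 ≤ γ) (hγ1 : γ < 1) (g : S → A → ℝ) :
    ∃ f : S → A → ℝ,
      ∀ s a, f s a = g s a + γ * ∑ s', P s a s' * ∑ a', π s' a' * f s' a' := by
  let L : (S → A → ℝ) →ₗ[ℝ] (S → A → ℝ) :=
    { toFun := fun f s a => f s a - γ * ∑ s', P s a s' * ∑ a', π s' a' * f s' a'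
      map_add' := fun f₁ f₂ => by
        ext s a
        simp only [Pi.add_apply, mul_add, Finset.sum_add_distrib]
        ring
      map_smul' := fun c f => by
        ext s a
        simp only [Pi.smul_apply, smul_eq_mul, RingHom.id_apply, mul_sub, Finset.mul_sum]
        congr 1
        exact Finset.sum_congr rfl fun _ _ => Finset.sum_congr rfl fun _ _ => by ring }
  have hinj : Function.Injective L := by
    rw [injective_iff_map_eq_zero]
    intro f hf
    have hfix : ∀ s a, f s a = γ * ∑ s', P s a s' * ∑ a', π s' a' * f s' a' :=
      fun s a => sub_eq_zero.mp (congrFun (congrFun hf s) a)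
    obtain ⟨⟨s₀, a₀⟩, hmax⟩ := Finite.exists_max fun x : S × A => |f x.1 x.2|
    have hV : ∀ s', |∑ a', π s' a' * f s' a'| ≤ |f s₀ a₀| := fun s' =>
      calc |∑ a', π s' a' * f s' a'| ≤ ∑ a', |π s' a' * f s' a'| :=
            Finset.abs_sum_le_sum_abs _ _
        _ ≤ ∑ a', π s' a' * |f s₀ a₀| := Finset.sum_le_sum fun a' _ => by
            rw [abs_mul, abs_of_nonneg (hπ_nonneg s' a')]
            exact mul_le_mul_of_nonneg_left (hmax (s', a')) (hπ_nonneg s' a')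
        _ = |f s₀ a₀| := by rw [← Finset.sum_mul, hπ_sum, one_mul]
    have hPV : |∑ s', P s₀ a₀ s' * ∑ a', π s' a' * f s' a'| ≤ |f s₀ a₀| :=
      calc |∑ s', P s₀ a₀ s' * ∑ a', π s' a' * f s' a'|
          ≤ ∑ s', |P s₀ a₀ s' * ∑ a', π s' a' * f s' a'| := Finset.abs_sum_le_sum_abs _ _
        _ ≤ ∑ s', P s₀ a₀ s' * |f s₀ a₀| := Finset.sum_le_sum fun s' _ => by
            rw [abs_mul, abs_of_nonneg (hP_nonneg s₀ a₀ s')]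
            exact mul_le_mul_of_nonneg_left (hV s') (hP_nonneg s₀ a₀ s')
        _ = |f s₀ a₀| := by rw [← Finset.sum_mul, hP_sum, one_mul]
    have hle : |f s₀ a₀| ≤ γ * |f s₀ a₀| := by
      conv_lhs => rw [hfix s₀ a₀, abs_mul, abs_of_nonneg hγ0]
      exact mul_le_mul_of_nonneg_left hPV hγ0
    have hzero : |f s₀ a₀| ≤ 0 := by nlinarith [abs_nonneg (f s₀ a₀)]
    ext s a
    exact abs_nonpos_iff.mp ((hmax (s, a)).trans hzero)
  obtain ⟨f, hf⟩ := LinearMap.injective_iff_surjective.mp hinj g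
  exact ⟨f, fun s a => sub_eq_iff_eq_add.mp (congrFun (congrFun hf s) a)⟩

end BellmanHelpers

/-- Discounted-visitation IPM identity: in a finite MDP with discount `γ ∈ [0,1)`, policy
`π_φ` with discounted visitation `d_φ`, and a distribution `d_b` on `S × A` whose state
marginal `ν` satisfies the discounted flow equation, if `f` solves the Bellman equation
for `g` under `π_φ`, then
`E_{d_φ}[g] − E_{d_b}[g] = E_{s∼ν, a∼π_φ}[f] − E_{d_b}[f]`; consequently for any class
`𝒢` of reward functions, `sup_{g∈𝒢} |E_{d_φ}[g] − E_{d_b}[g]|` equals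
`sup_{f∈ℱ} |E_{d_b}[f] − E_{s∼ν, a∼π_φ}[f]|`, where `ℱ` is the set of Bellman solutions
corresponding to members of `𝒢`. -/
theorem discounted_ipm_identity
    {S A : Type*} [Fintype S] [Fintype A] [Nonempty S] [Nonempty A]
    (P : S → A → S → ℝ) (hP_nonneg : ∀ s a s', 0 ≤ P s a s')
    (hP_sum : ∀ s a, ∑ s', P s a s' = 1)
    (πφ : S → A → ℝ) (hπφ_nonneg : ∀ s a, 0 ≤ πφ s a) (hπφ_sum : ∀ s, ∑ a, πφ s a = 1)
    (μ0 : S → ℝ) (hμ0_nonneg : ∀ s, 0 ≤ μ0 s) (hμ0_sum : ∑ s, μ0 s = 1)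
    (γ : ℝ) (hγ0 : 0 ≤ γ) (hγ1 : γ < 1)
    (ρ : ℕ → S → A → ℝ)
    (hρ0 : ∀ s a, ρ 0 s a = μ0 s * πφ s a)
    (hρsucc : ∀ t s' a', ρ (t + 1) s' a' = (∑ s, ∑ a, ρ t s a * P s a s') * πφ s' a')
    (dφ : S → A → ℝ)
    (hdφ : ∀ s a, dφ s a = (1 - γ) * ∑' t : ℕ, γ ^ t * ρ t s a)
    (db : S → A → ℝ) (hdb_nonneg : ∀ s a, 0 ≤ db s a) (hdb_sum : ∑ s, ∑ a, db s a = 1)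
    (ν : S → ℝ) (hν : ∀ s, ν s = ∑ a, db s a)
    (hflow : ∀ s', γ * (∑ s, ∑ a, db s a * P s a s') - ν s' + (1 - γ) * μ0 s' = 0)
    (g f : S → A → ℝ)
    (hf : ∀ s a, f s a = g s a + γ * ∑ s', P s a s' * ∑ a', πφ s' a' * f s' a') :
    ((∑ s, ∑ a, dφ s a * g s a) - (∑ s, ∑ a, db s a * g s a)
      = (∑ s, ν s * ∑ a, πφ s a * f s a) - (∑ s, ∑ a, db s a * f s a))
    ∧ ∀ 𝒢 : Set (S → A → ℝ),
        sSup ((fun g0 => |(∑ s, ∑ a, dφ s a * g0 s a) - ∑ s, ∑ a, db s a * g0 s a|) '' 𝒢)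
          = sSup ((fun f0 : S → A → ℝ =>
                |(∑ s, ∑ a, db s a * f0 s a) - ∑ s, ν s * ∑ a, πφ s a * f0 s a|) ''
              {f0 : S → A → ℝ | ∃ g0 ∈ 𝒢, ∀ s a,
                f0 s a = g0 s a + γ * ∑ s', P s a s' * ∑ a', πφ s' a' * f0 s' a'}) := by
  have hρ := stateAction_marginal_nonneg_sum_eq_one hP_nonneg hP_sum hπφ_nonneg hπφ_sum
    hμ0_nonneg hμ0_sum hρ0 hρsucc
  have hρ_le : ∀ t s a, ρ t s a ≤ 1 := fun t s a =>
    calc ρ t s a ≤ ∑ a', ρ t s a' :=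
          Finset.single_le_sum (fun a' _ => (hρ t).1 s a') (Finset.mem_univ a)
      _ ≤ ∑ s', ∑ a', ρ t s' a' :=
          Finset.single_le_sum (f := fun s' => ∑ a', ρ t s' a')
            (fun s' _ => Finset.sum_nonneg fun a' _ => (hρ t).1 s' a') (Finset.mem_univ s)
      _ = 1 := (hρ t).2
  have hsum : ∀ s a, Summable fun t : ℕ => γ ^ t * ρ t s a := fun s a =>
    (summable_geometric_of_lt_one hγ0 hγ1).of_nonneg_of_le
      (fun t => mul_nonneg (pow_nonneg hγ0 t) ((hρ t).1 s a))
      (fun t => mul_le_of_le_one_right (pow_nonneg hγ0 t) (hρ_le t s a))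
  have key : ∀ g f : S → A → ℝ,
      (∀ s a, f s a = g s a + γ * ∑ s', P s a s' * ∑ a', πφ s' a' * f s' a') →
      (∑ s, ∑ a, dφ s a * g s a) - (∑ s, ∑ a, db s a * g s a)
        = (∑ s, ν s * ∑ a, πφ s a * f s a) - (∑ s, ∑ a, db s a * f s a) := by
    intro g f hf
    have hvis : ∑ s, ∑ a, dφ s a * f s a
        = ∑ s, ((1 - γ) * μ0 s + γ * ∑ s₁, ∑ a₁, dφ s₁ a₁ * P s₁ a₁ s)
          * ∑ a, πφ s a * f s a := by
      refine Finset.sum_congr rfl fun s _ => ?_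
      rw [Finset.mul_sum]
      refine Finset.sum_congr rfl fun a _ => ?_
      rw [← mul_assoc, ← discounted_visitation_flow hρ0 hρsucc hsum hdφ]
    have hflow' : ∀ s', γ * (∑ s, ∑ a, db s a * P s a s') = ν s' - (1 - γ) * μ0 s' :=
      fun s' => by linarith [hflow s']
    rw [sum_mul_bellman_eq hf dφ, sum_mul_bellman_eq hf db, hvis]
    simp only [hflow', add_mul, sub_mul (ν _), Finset.sum_add_distrib, Finset.sum_sub_distrib]
    ring
  refine ⟨key g f hf, fun 𝒢 => congrArg sSup (Set.ext fun x => ⟨?_, ?_⟩)⟩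
  · rintro ⟨g₀, hg₀, rfl⟩
    obtain ⟨f₀, hf₀⟩ :=
      exists_bellman_solution hP_nonneg hP_sum hπφ_nonneg hπφ_sum hγ0 hγ1 g₀
    refine ⟨f₀, ⟨g₀, hg₀, hf₀⟩, ?_⟩
    dsimp only
    rw [key g₀ f₀ hf₀, abs_sub_comm]
  · rintro ⟨f₀, ⟨g₀, hg₀, hf₀⟩, rfl⟩
    refine ⟨g₀, hg₀, ?_⟩
    dsimp only
    rw [key g₀ f₀ hf₀, abs_sub_comm]
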